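/- arXiv:2004.12654 — 2 statements merged into one kernel-verified Lean document; each statement's English description precedes it below -/
import Mathlib

section
/- For every α, ℓ > 0 and n ≥ 1, I_α(φ_{ℓ,2n}) − Q_{α,ℓ,n}^{GH}(φ_{ℓ,2n}) = C_n (β/α) (β²/(2ℓ²))^n n^{1/4}, where β = αℓ/√(α² + ℓ²). -/
open MeasureTheory Real Filter

noncomputable section

/-- The orthonormal basis functions of the Gaussian RKHS. -/
def phi (ℓ : ℝ) (m : ℕ) (x : ℝ) : ℝ :=
  x ^ m * Real.exp (-x ^ 2 / (2 * ℓ ^ 2)) / (ℓ ^ m * Real.sqrt (Nat.factorial m))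

/-- The univariate Gaussian integral functional. -/
def Igauss (α : ℝ) (f : ℝ → ℝ) : ℝ :=
  (Real.sqrt (2 * Real.pi) * α)⁻¹ * ∫ x : ℝ, f x * Real.exp (-x ^ 2 / (2 * α ^ 2))

/-- β = αℓ/√(α² + ℓ²). -/
def betaP (α ℓ : ℝ) : ℝ := α * ℓ / Real.sqrt (α ^ 2 + ℓ ^ 2)

/-- C_n = 2^n n! n^{−1/4} / √((2n)!). -/
def Cseq (n : ℕ) : ℝ :=
  2 ^ n * (Nat.factorial n : ℝ) * (n : ℝ) ^ (-(1 / 4 : ℝ)) / Real.sqrt (Nat.factorial (2 * n))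

/-- ω_γ = 2γ²/(1 + 2γ² + √(1+4γ²)). -/
def omegaP (γ : ℝ) : ℝ := 2 * γ ^ 2 / (1 + 2 * γ ^ 2 + Real.sqrt (1 + 4 * γ ^ 2))

/-- C̄_n(γ). -/
def Cbar (γ : ℝ) (n : ℕ) : ℝ :=
  Real.sqrt (2 * (1 + 4 * γ ^ 2) ^ ((1 : ℝ) / 4) /
      ((1 + 2 * γ ^ 2 + Real.sqrt (1 + 4 * γ ^ 2)) * Real.exp 1)) *
    ((Nat.factorial n : ℝ) / (Nat.factorial (2 * n) : ℝ)) *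
    (Real.exp 1 / (4 * (n : ℝ))) ^ (-(n : ℤ))

/-- `x`, `w` are the nodes and weights of the n-point Gauss–Hermite rule: the nodes are the
n distinct roots of the probabilists' Hermite polynomial H_n, the weights are positive, and
the rule integrates exactly all polynomials of degree at most 2n−1 against the standard
Gaussian weight. -/
def IsGaussHermite (n : ℕ) (x w : Fin n → ℝ) : Prop :=
  Function.Injective x ∧
  (∀ i, Polynomial.aeval (x i) (Polynomial.hermite n) = 0) ∧
  (∀ i, 0 < w i) ∧
  ∀ p : Polynomial ℝ, p.natDegree ≤ 2 * n - 1 →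
    ∑ i, w i * p.eval (x i)
      = (Real.sqrt (2 * Real.pi))⁻¹ * ∫ t : ℝ, p.eval t * Real.exp (-t ^ 2 / 2)

/-- The scaled Gauss–Hermite rule Q_{α,ℓ,n}^{GH}. -/
def QGH (α ℓ : ℝ) {n : ℕ} (x w : Fin n → ℝ) (f : ℝ → ℝ) : ℝ :=
  betaP α ℓ / α *
    ∑ i, w i * Real.exp (betaP α ℓ ^ 2 * x i ^ 2 / (2 * ℓ ^ 2)) * f (betaP α ℓ * x i)

/-- Membership in the unit ball of the Gaussian RKHS H(K_ℓ). -/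
def InBall (ℓ : ℝ) (f : ℝ → ℝ) : Prop :=
  ∃ c : ℕ → ℝ, (∀ x, HasSum (fun m => c m * phi ℓ m x) (f x)) ∧
    Summable (fun m => c m ^ 2) ∧ (∑' m, c m ^ 2) ≤ 1

/-- Worst-case error of a quadrature functional over the unit ball of H(K_ℓ). -/
def wce1 (α ℓ : ℝ) (Q : (ℝ → ℝ) → ℝ) : ℝ :=
  sSup {e : ℝ | ∃ f : ℝ → ℝ, InBall ℓ f ∧ e = |Igauss α f - Q f|}

/-- The n-th minimal worst-case error (univariate). -/
def minErr1 (α ℓ : ℝ) (n : ℕ) : ℝ :=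
  ⨅ p : (Fin n → ℝ) × (Fin n → ℝ), wce1 α ℓ fun f => ∑ i, p.2 i * f (p.1 i)

/-- The multivariate Gaussian integral functional. -/
def IgaussD {d : ℕ} (α : Fin d → ℝ) (f : (Fin d → ℝ) → ℝ) : ℝ :=
  ∫ x : Fin d → ℝ,
    f x * ∏ i, (Real.sqrt (2 * Real.pi) * α i)⁻¹ * Real.exp (-(x i) ^ 2 / (2 * α i ^ 2))

/-- Membership in the unit ball of the tensor-product Gaussian RKHS H(K_ℓ), ℓ ∈ ℝ^d. -/
def InBallD {d : ℕ} (ℓ : Fin d → ℝ) (f : (Fin d → ℝ) → ℝ) : Prop :=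
  ∃ c : (Fin d → ℕ) → ℝ,
    (∀ x, HasSum (fun m => c m * ∏ i, phi (ℓ i) (m i) (x i)) (f x)) ∧
    Summable (fun m => c m ^ 2) ∧ (∑' m, c m ^ 2) ≤ 1

/-- Worst-case error of a multivariate quadrature functional. -/
def wceD {d : ℕ} (α ℓ : Fin d → ℝ) (Q : ((Fin d → ℝ) → ℝ) → ℝ) : ℝ :=
  sSup {e : ℝ | ∃ f, InBallD ℓ f ∧ e = |IgaussD α f - Q f|}

/-- The N-th minimal worst-case error in dimension d. -/
def minErrD {d : ℕ} (α ℓ : Fin d → ℝ) (N : ℕ) : ℝ :=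
  ⨅ p : (Fin N → (Fin d → ℝ)) × (Fin N → ℝ), wceD α ℓ fun f => ∑ i, p.2 i * f (p.1 i)

/-- The tensor-product scaled Gauss–Hermite rule. -/
def QGHD {d : ℕ} (α ℓ : Fin d → ℝ) (n : Fin d → ℕ)
    (x w : ∀ j, Fin (n j) → ℝ) (f : (Fin d → ℝ) → ℝ) : ℝ :=
  ∑ i : ∀ j, Fin (n j),
    (∏ j, betaP (α j) (ℓ j) / α j * w j (i j) *
        Real.exp (betaP (α j) (ℓ j) ^ 2 * x j (i j) ^ 2 / (2 * ℓ j ^ 2))) *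
      f fun j => betaP (α j) (ℓ j) * x j (i j)

/-- The power function of a finite point set (univariate). -/
def power1 (ℓ : ℝ) (X : Finset ℝ) (x : ℝ) : ℝ :=
  sSup {v : ℝ | ∃ f, InBall ℓ f ∧ (∀ y ∈ X, f y = 0) ∧ v = f x}

/-- Fill distance of X on Ω (univariate). -/
def fillDist1 (X : Finset ℝ) (Ω : Set ℝ) : ℝ :=
  sSup {h : ℝ | ∃ x ∈ Ω, h = sInf {r : ℝ | ∃ y ∈ X, y ∈ Ω ∧ r = |x - y|}}

/-- Euclidean distance on ℝ^d. -/
def eucDist {d : ℕ} (x y : Fin d → ℝ) : ℝ := Real.sqrt (∑ i, (x i - y i) ^ 2)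

/-- The power function of a finite point set in ℝ^d for the isotropic Gaussian kernel. -/
def powerD {d : ℕ} (ℓ : ℝ) (X : Finset (Fin d → ℝ)) (x : Fin d → ℝ) : ℝ :=
  sSup {v : ℝ | ∃ f, InBallD (fun _ => ℓ) f ∧ (∀ y ∈ X, f y = 0) ∧ v = f x}

/-- Fill distance of X on Ω ⊂ ℝ^d (Euclidean). -/
def fillDistD {d : ℕ} (X : Finset (Fin d → ℝ)) (Ω : Set (Fin d → ℝ)) : ℝ :=
  sSup {h : ℝ | ∃ x ∈ Ω, h = sInf {r : ℝ | ∃ y ∈ X, y ∈ Ω ∧ r = eucDist x y}}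

/-- Worst-case error of the optimal-weight (kernel quadrature) rule with nodes X (univariate). -/
def eopt1 (α ℓ : ℝ) (X : Finset ℝ) : ℝ :=
  ⨅ w : ℝ → ℝ, wce1 α ℓ fun f => ∑ y ∈ X, w y * f y

/-- Worst-case error of the optimal-weight rule with nodes X ⊂ ℝ^d. -/
def eoptD {d : ℕ} (α ℓ : Fin d → ℝ) (X : Finset (Fin d → ℝ)) : ℝ :=
  ⨅ w : (Fin d → ℝ) → ℝ, wceD α ℓ fun f => ∑ y ∈ X, w y * f y

/-- The point sets X_k = ∪_{m=1}^k (Y_{k−m+1}^{m,+} ∪ Y_{k−m+1}^{m,−}). -/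
def Xk (Y : ℕ → Finset ℝ) (k : ℕ) : Finset ℝ :=
  (Finset.Icc 1 k).biUnion fun m =>
    ((Y (k - m + 1)).image fun x => x + (m : ℝ) - 1) ∪
      ((Y (k - m + 1)).image fun x => x - (m : ℝ))


section GaussianHermite

open Polynomial

lemma integrable_eval_mul_gaussian (p : ℝ[X]) :
    Integrable fun t : ℝ => p.eval t * Real.exp (-t ^ 2 / 2) := by
  induction p using Polynomial.induction_on' with
  | add p q hp hq =>
    simp only [eval_add, add_mul]
    exact hp.add hq
  | monomial k a =>
    have h := (integrable_rpow_mul_exp_neg_mul_sq (b := 1 / 2) (by norm_num)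
      (s := k) (lt_of_lt_of_le neg_one_lt_zero (Nat.cast_nonneg k))).const_mul a
    refine h.congr (Eventually.of_forall fun t => ?_)
    simp only [eval_monomial, Real.rpow_natCast, mul_assoc]
    ring_nf

lemma integral_X_mul_sub_derivative_gaussian (p : ℝ[X]) :
    ∫ t : ℝ, (X * p - derivative p).eval t * Real.exp (-t ^ 2 / 2) = 0 := by
  refine integral_eq_zero_of_hasDerivAt_of_integrable
    (f := fun t : ℝ => -(p.eval t * Real.exp (-t ^ 2 / 2))) (fun t => ?_)
    (integrable_eval_mul_gaussian _) (integrable_eval_mul_gaussian p).neg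
  have hg : HasDerivAt (fun t : ℝ => -t ^ 2 / 2) (-t) t := by
    convert! ((hasDerivAt_pow 2 t).neg.div_const 2) using 1
    norm_num
    ring
  convert! ((p.hasDerivAt t).mul hg.exp).neg using 1
  simp only [eval_sub, eval_mul, eval_X]
  ring

lemma integral_hermite_mul_gaussian (n : ℕ) (q : ℝ[X]) :
    ∫ t : ℝ, ((hermite n).map (Int.castRingHom ℝ) * q).eval t * Real.exp (-t ^ 2 / 2) =
      ∫ t : ℝ, (derivative^[n] q).eval t * Real.exp (-t ^ 2 / 2) := by
  induction n generalizing q with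
  | zero => simp
  | succ n ih =>
    rw [Function.iterate_succ_apply, ← ih (derivative q)]
    set H := (hermite n).map (Int.castRingHom ℝ) with hH
    have hsplit : (hermite (n + 1)).map (Int.castRingHom ℝ) * q =
        (X * (H * q) - derivative (H * q)) + H * derivative q := by
      rw [hermite_succ, Polynomial.map_sub, Polynomial.map_mul, map_X, ← derivative_map, ← hH,
        derivative_mul]
      ring
    rw [hsplit]
    simp only [eval_add (p := _ - _), add_mul]
    rw [integral_add (integrable_eval_mul_gaussian _) (integrable_eval_mul_gaussian _),
      integral_X_mul_sub_derivative_gaussian, zero_add]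

lemma integral_hermite_sq_gaussian (n : ℕ) :
    (Real.sqrt (2 * Real.pi))⁻¹ * ∫ t : ℝ,
      ((hermite n).map (Int.castRingHom ℝ) * (hermite n).map (Int.castRingHom ℝ)).eval t *
        Real.exp (-t ^ 2 / 2) = n.factorial := by
  have hdeg : ((hermite n).map (Int.castRingHom ℝ)).natDegree = n := by
    rw [(hermite_monic n).natDegree_map, natDegree_hermite]
  have hd : derivative^[n] ((hermite n).map (Int.castRingHom ℝ)) = C (n.factorial : ℝ) := by
    refine (eq_C_of_natDegree_le_zero ?_).trans ?_
    · have := natDegree_iterate_derivative ((hermite n).map (Int.castRingHom ℝ)) n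
      omega
    · rw [coeff_iterate_derivative]
      simp [Nat.descFactorial_self]
  have hg : ∫ t : ℝ, Real.exp (-t ^ 2 / 2) = Real.sqrt (2 * Real.pi) := by
    have h := integral_gaussian (1 / 2)
    rw [show Real.pi / (1 / 2) = 2 * Real.pi by ring] at h
    rw [← h]
    congr 1 with t
    ring_nf
  rw [integral_hermite_mul_gaussian, hd]
  simp only [eval_C]
  rw [integral_const_mul, hg]
  have : Real.sqrt (2 * Real.pi) ≠ 0 := (Real.sqrt_pos.2 (by positivity)).ne'
  field_simp

lemma IsGaussHermite.integral_sub_sum_pow {n : ℕ} (hn : 1 ≤ n) {x w : Fin n → ℝ}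
    (h : IsGaussHermite n x w) :
    (Real.sqrt (2 * Real.pi))⁻¹ * (∫ t : ℝ, t ^ (2 * n) * Real.exp (-t ^ 2 / 2)) -
      ∑ i, w i * x i ^ (2 * n) = n.factorial := by
  obtain ⟨-, hroot, -, hexact⟩ := h
  set H := (hermite n).map (Int.castRingHom ℝ) with hH
  have hmonic : H.Monic := (hermite_monic n).map _
  have hdeg : H.natDegree = n := by
    rw [hH, (hermite_monic n).natDegree_map, natDegree_hermite]
  have hlt : (X ^ (2 * n) - H * H : ℝ[X]).degree < ((2 * n : ℕ) : WithBot ℕ) := by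
    have hHH : (H * H).degree = ((2 * n : ℕ) : WithBot ℕ) := by
      rw [degree_eq_natDegree (hmonic.mul hmonic).ne_zero, hmonic.natDegree_mul hmonic, hdeg,
        two_mul]
    rw [← degree_X_pow (R := ℝ) (2 * n)]
    exact degree_sub_lt_left (by rw [hHH, degree_X_pow]) (monic_X_pow _).ne_zero
      (by rw [(monic_X_pow _).leadingCoeff, (hmonic.mul hmonic).leadingCoeff])
  have hp : (X ^ (2 * n) - H * H : ℝ[X]).natDegree ≤ 2 * n - 1 := by
    refine natDegree_le_iff_coeff_eq_zero.2 fun N hN => coeff_eq_zero_of_degree_lt ?_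
    exact hlt.trans_le (by exact_mod_cast (by omega : 2 * n ≤ N))
  have hHx (i : Fin n) : H.eval (x i) = 0 := by
    rw [hH, ← hroot i, aeval_def, eval_map]
    rfl
  have hsum := hexact _ hp
  have hsplit : ∀ t : ℝ, (X ^ (2 * n) - H * H : ℝ[X]).eval t * Real.exp (-t ^ 2 / 2) =
      (X ^ (2 * n) : ℝ[X]).eval t * Real.exp (-t ^ 2 / 2) -
        (H * H).eval t * Real.exp (-t ^ 2 / 2) := fun t => by rw [eval_sub, sub_mul]
  simp only [hsplit] at hsum
  rw [integral_sub (integrable_eval_mul_gaussian _) (integrable_eval_mul_gaussian _), mul_sub,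
    integral_hermite_sq_gaussian] at hsum
  simp only [eval_sub, eval_mul, eval_pow, eval_X, hHx, mul_zero, sub_zero] at hsum
  rw [hsum]
  ring

end GaussianHermite

lemma betaP_pos {α ℓ : ℝ} (hα : 0 < α) (hℓ : 0 < ℓ) : 0 < betaP α ℓ := by
  unfold betaP
  positivity

lemma betaP_sq {α ℓ : ℝ} (hα : 0 < α) :
    betaP α ℓ ^ 2 = α ^ 2 * ℓ ^ 2 / (α ^ 2 + ℓ ^ 2) := by
  rw [betaP, div_pow, Real.sq_sqrt (by positivity), mul_pow]

lemma Igauss_phi {α ℓ : ℝ} (hα : 0 < α) (hℓ : 0 < ℓ) (m : ℕ) :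
    Igauss α (phi ℓ m) = betaP α ℓ / α * (betaP α ℓ ^ m / (ℓ ^ m * Real.sqrt m.factorial)) *
      ((Real.sqrt (2 * Real.pi))⁻¹ * ∫ t : ℝ, t ^ m * Real.exp (-t ^ 2 / 2)) := by
  have hβ := betaP_pos hα hℓ
  have hβ2 := betaP_sq (ℓ := ℓ) hα
  set β := betaP α ℓ
  have hpt : ∀ x : ℝ, phi ℓ m x * Real.exp (-x ^ 2 / (2 * α ^ 2)) =
      β ^ m / (ℓ ^ m * Real.sqrt m.factorial) *
        ((x / β) ^ m * Real.exp (-(x / β) ^ 2 / 2)) := fun x => by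
    have hexp : Real.exp (-(x / β) ^ 2 / 2) =
        Real.exp (-x ^ 2 / (2 * ℓ ^ 2)) * Real.exp (-x ^ 2 / (2 * α ^ 2)) := by
      rw [← Real.exp_add, div_pow, hβ2]
      congr 1
      field_simp
      ring
    rw [hexp, phi, div_pow]
    field_simp
  rw [Igauss]
  simp only [hpt]
  rw [integral_const_mul,
    Measure.integral_comp_div (fun t : ℝ => t ^ m * Real.exp (-t ^ 2 / 2)) β,
    abs_of_pos hβ, smul_eq_mul, mul_inv]
  ring

lemma QGH_phi {α ℓ : ℝ} {n : ℕ} (x w : Fin n → ℝ) (m : ℕ) :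
    QGH α ℓ x w (phi ℓ m) =
      betaP α ℓ / α * (betaP α ℓ ^ m / (ℓ ^ m * Real.sqrt m.factorial)) *
        ∑ i, w i * x i ^ m := by
  rw [QGH, mul_assoc (betaP α ℓ / α), Finset.mul_sum (a := _ ^ m / _)]
  congr 1
  refine Finset.sum_congr rfl fun i _ => ?_
  have hexp : Real.exp (betaP α ℓ ^ 2 * x i ^ 2 / (2 * ℓ ^ 2)) *
      Real.exp (-(betaP α ℓ * x i) ^ 2 / (2 * ℓ ^ 2)) = 1 := by
    rw [← Real.exp_add, Real.exp_eq_one_iff]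
    ring
  rw [phi, mul_pow (n := m)]
  linear_combination w i * (betaP α ℓ ^ m * x i ^ m / (ℓ ^ m * Real.sqrt m.factorial)) * hexp


/-- exact error of the scaled Gauss–Hermite rule on φ_{ℓ,2n}. -/
theorem stmt2 (α ℓ : ℝ) (hα : 0 < α) (hℓ : 0 < ℓ) (n : ℕ) (hn : 1 ≤ n)
    (x w : Fin n → ℝ) (hGH : IsGaussHermite n x w) :
    Igauss α (phi ℓ (2 * n)) - QGH α ℓ x w (phi ℓ (2 * n))
      = Cseq n * (betaP α ℓ / α) * (betaP α ℓ ^ 2 / (2 * ℓ ^ 2)) ^ n *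
          (n : ℝ) ^ ((1 : ℝ) / 4) := by
  have hn0 : (0 : ℝ) < n := by exact_mod_cast hn
  have hroot : (n : ℝ) ^ (-(1 / 4 : ℝ)) * (n : ℝ) ^ ((1 : ℝ) / 4) = 1 := by
    rw [← Real.rpow_add hn0]
    norm_num
  rw [Igauss_phi hα hℓ, QGH_phi, ← mul_sub, hGH.integral_sub_sum_pow hn, Cseq, div_pow,
    mul_pow 2, ← pow_mul, ← pow_mul]
  calc betaP α ℓ / α * (betaP α ℓ ^ (2 * n) / (ℓ ^ (2 * n) * √↑(2 * n).factorial)) *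
        ↑n.factorial
      = betaP α ℓ / α * (betaP α ℓ ^ (2 * n) / (ℓ ^ (2 * n) * √↑(2 * n).factorial)) *
        ↑n.factorial * ((n : ℝ) ^ (-(1 / 4 : ℝ)) * (n : ℝ) ^ ((1 : ℝ) / 4)) := by
        rw [hroot, mul_one]
    _ = _ := by field_simp

end
end

section
/- For every n ≥ 1 and every s with 0 ≤ s < 1, the n-point Gauss–Hermite rule satisfies Σ_{i=1}^n w_{n,i} exp(s x_{n,i}²/2) ≤ (1 − s)^{−1/2} = (1/√(2π)) ∫_ℝ exp(s x²/2) exp(−x²/2) dx. -/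
open MeasureTheory Real Filter

noncomputable section

open Polynomial in
theorem derivative_hermite_succ (n : ℕ) :
    derivative (hermite (n + 1)) = ((n : ℤ[X]) + 1) * hermite n := by
  induction n with
  | zero => simp
  | succ n ih =>
    rw [hermite_succ (n + 1), derivative_sub, derivative_mul, ih, hermite_succ n]
    have hc : ((n : ℤ[X]) + 1) = C ((n : ℤ) + 1) := by simp
    have hd : derivative (((n : ℤ[X]) + 1) * hermite n)
        = ((n : ℤ[X]) + 1) * derivative (hermite n) := by
      rw [hc, derivative_C_mul]
    rw [hd]
    push_cast
    simp only [derivative_X]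
    ring

open Polynomial in
/-- The probabilists' Hermite polynomial with real coefficients. -/
def realHermite (n : ℕ) : ℝ[X] := (hermite n).map (Int.castRingHom ℝ)

open Polynomial in
theorem X_mul_realHermite_zero : X * realHermite 0 = realHermite 1 := by
  simp [realHermite]

open Polynomial in
theorem realHermite_succ (n : ℕ) :
    realHermite (n + 1) = X * realHermite n - derivative (realHermite n) := by
  simp [realHermite, hermite_succ, Polynomial.derivative_map]

open Polynomial in
theorem X_mul_realHermite_succ (n : ℕ) :
    X * realHermite (n + 1) = realHermite (n + 2) + ((n : ℝ) + 1) • realHermite n := by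
  have h := congrArg (Polynomial.map (Int.castRingHom ℝ)) (derivative_hermite_succ n)
  rw [realHermite_succ (n + 1), smul_eq_C_mul]
  simp only [Polynomial.derivative_map, realHermite] at h ⊢
  rw [h]
  simp

theorem natDegree_realHermite (n : ℕ) : (realHermite n).natDegree = n := by
  rw [realHermite, (Polynomial.hermite_monic n).natDegree_map, Polynomial.natDegree_hermite]

theorem integrable_eval_mul_exp (p : Polynomial ℝ) :
    Integrable fun t : ℝ => p.eval t * Real.exp (-t ^ 2 / 2) := by
  induction p using Polynomial.induction_on' with
  | add p q hp hq =>
    simp only [Polynomial.eval_add, add_mul]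
    exact hp.add hq
  | monomial k a =>
    have h := (integrable_rpow_mul_exp_neg_mul_sq (b := 1 / 2) (by norm_num)
      (s := (k : ℝ)) (by linarith [Nat.cast_nonneg (α := ℝ) k])).const_mul a
    refine h.congr (Eventually.of_forall fun t => ?_)
    simp only [Polynomial.eval_monomial, Real.rpow_natCast, mul_assoc]
    congr 3
    ring

/-- Expectation of a polynomial under the standard Gaussian. -/
def gaussExp : Polynomial ℝ →ₗ[ℝ] ℝ where
  toFun p := (Real.sqrt (2 * Real.pi))⁻¹ * ∫ t : ℝ, p.eval t * Real.exp (-t ^ 2 / 2)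
  map_add' p q := by
    simp only [Polynomial.eval_add, add_mul]
    rw [integral_add (integrable_eval_mul_exp p) (integrable_eval_mul_exp q), mul_add]
  map_smul' a p := by
    simp only [Polynomial.eval_smul, smul_eq_mul, mul_assoc, integral_const_mul, RingHom.id_apply]
    ring

theorem gaussExp_apply (p : Polynomial ℝ) : gaussExp p =
    (Real.sqrt (2 * Real.pi))⁻¹ * ∫ t : ℝ, p.eval t * Real.exp (-t ^ 2 / 2) := rfl

open Polynomial in
theorem gaussExp_X_mul_sub_derivative (p : ℝ[X]) : gaussExp (X * p - derivative p) = 0 := by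
  have hd : ∀ t : ℝ, HasDerivAt (fun t => p.eval t * Real.exp (-t ^ 2 / 2))
      (-((X * p - derivative p).eval t * Real.exp (-t ^ 2 / 2))) t := by
    intro t
    have h1 : HasDerivAt (fun t : ℝ => -t ^ 2 / 2) (-t) t := by
      convert! ((hasDerivAt_pow 2 t).neg.div_const 2) using 1
      push_cast
      ring
    convert! (p.hasDerivAt t).mul h1.exp using 1
    simp only [eval_sub, eval_mul, eval_X]
    ring
  have h := integral_eq_zero_of_hasDerivAt_of_integrable hd
    (integrable_eval_mul_exp _).neg (integrable_eval_mul_exp p)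
  rw [integral_neg, neg_eq_zero] at h
  rw [gaussExp_apply, h, mul_zero]

theorem gaussExp_realHermite_nonneg (n : ℕ) : 0 ≤ gaussExp (realHermite n) := by
  cases n with
  | zero =>
    rw [gaussExp_apply]
    refine mul_nonneg (by positivity) (integral_nonneg fun t => ?_)
    simp [realHermite, Real.exp_nonneg]
  | succ n => rw [realHermite_succ, gaussExp_X_mul_sub_derivative]

open Polynomial in
theorem gaussExp_X_pow_mul_realHermite_nonneg (m n : ℕ) :
    0 ≤ gaussExp (X ^ m * realHermite n) := by
  induction m generalizing n with
  | zero => simpa using gaussExp_realHermite_nonneg n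
  | succ m ih =>
    rw [pow_succ, mul_assoc]
    cases n with
    | zero => rw [X_mul_realHermite_zero]; exact ih 1
    | succ n =>
      rw [X_mul_realHermite_succ, mul_add, mul_smul_comm, map_add, map_smul, smul_eq_mul]
      exact add_nonneg (ih _) (mul_nonneg (by positivity) (ih _))

open Polynomial in
/-- The Gauss–Hermite rule underestimates the Gaussian expectation of `X ^ m * H_j`, `j ≤ n`. -/
theorem IsGaussHermite.sum_le_gaussExp {n : ℕ} (hn : 1 ≤ n) {x w : Fin n → ℝ}
    (h : IsGaussHermite n x w) (m j : ℕ) (hj : j ≤ n) :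
    ∑ i, w i * (X ^ m * realHermite j).eval (x i) ≤ gaussExp (X ^ m * realHermite j) := by
  obtain ⟨-, hroot, -, hexact⟩ := h
  induction m generalizing j with
  | zero =>
    refine (hexact _ ?_).le
    rw [pow_zero, one_mul, natDegree_realHermite]
    omega
  | succ m ih =>
    rcases hj.eq_or_lt with rfl | hlt
    · have hz : ∀ i, (realHermite j).eval (x i) = 0 := fun i => by
        rw [← hroot i, realHermite, eval_map, aeval_def]
        rfl
      simp only [eval_mul, hz, mul_zero, Finset.sum_const_zero]
      exact gaussExp_X_pow_mul_realHermite_nonneg _ _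
    · rw [pow_succ, mul_assoc]
      cases j with
      | zero => rw [X_mul_realHermite_zero]; exact ih 1 hn
      | succ j =>
        rw [X_mul_realHermite_succ, mul_add, mul_smul_comm, map_add, map_smul]
        simp only [eval_add, eval_smul, smul_eq_mul, mul_add, Finset.sum_add_distrib,
          mul_left_comm (w _) ((j : ℝ) + 1), ← Finset.mul_sum]
        exact add_le_add (ih _ hlt) (mul_le_mul_of_nonneg_left (ih _ (by omega)) (by positivity))

theorem exp_mul_exp_neg_eq (s t : ℝ) :
    Real.exp (s * t ^ 2 / 2) * Real.exp (-t ^ 2 / 2) = Real.exp (-((1 - s) / 2) * t ^ 2) := by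
  rw [← Real.exp_add]
  ring_nf

theorem rpow_neg_half_eq_gaussian_integral {s : ℝ} (hs1 : s < 1) :
    (1 - s) ^ (-(1 / 2 : ℝ)) = (Real.sqrt (2 * Real.pi))⁻¹ *
      ∫ t : ℝ, Real.exp (s * t ^ 2 / 2) * Real.exp (-t ^ 2 / 2) := by
  have hs : 0 < 1 - s := sub_pos.2 hs1
  simp only [exp_mul_exp_neg_eq, integral_gaussian]
  rw [show Real.pi / ((1 - s) / 2) = (2 * Real.pi) / (1 - s) by field_simp,
    Real.sqrt_div (by positivity), Real.rpow_neg hs.le, ← Real.sqrt_eq_rpow]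
  field_simp

open Polynomial in
/-- Truncated power series of `exp (s t² / 2)`. -/
def expSqTrunc (s : ℝ) (K : ℕ) : ℝ[X] :=
  ∑ k ∈ Finset.range K, ((s / 2) ^ k / (Nat.factorial k : ℝ)) • (X : ℝ[X]) ^ (2 * k)

theorem eval_expSqTrunc (s t : ℝ) (K : ℕ) : (expSqTrunc s K).eval t =
    ∑ k ∈ Finset.range K, (s * t ^ 2 / 2) ^ k / (Nat.factorial k : ℝ) := by
  simp only [expSqTrunc, Polynomial.eval_finsetSum, Polynomial.eval_smul, Polynomial.eval_pow,
    Polynomial.eval_X, smul_eq_mul]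
  refine Finset.sum_congr rfl fun k _ => ?_
  rw [pow_mul, mul_div_right_comm s, mul_pow]
  ring

theorem tendsto_eval_expSqTrunc (s t : ℝ) :
    Tendsto (fun K => (expSqTrunc s K).eval t) atTop (nhds (Real.exp (s * t ^ 2 / 2))) := by
  simp only [eval_expSqTrunc, Real.exp_eq_exp_ℝ]
  exact (NormedSpace.expSeries_div_hasSum_exp (s * t ^ 2 / 2)).tendsto_sum_nat

theorem gaussExp_expSqTrunc_le {s : ℝ} (hs0 : 0 ≤ s) (hs1 : s < 1) (K : ℕ) :
    gaussExp (expSqTrunc s K) ≤ (1 - s) ^ (-(1 / 2 : ℝ)) := by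
  rw [rpow_neg_half_eq_gaussian_integral hs1, gaussExp_apply]
  refine mul_le_mul_of_nonneg_left
    (integral_mono (integrable_eval_mul_exp _) ?_ fun t => ?_) (by positivity)
  · simp only [exp_mul_exp_neg_eq]
    exact integrable_exp_neg_mul_sq (by linarith)
  · simp only [eval_expSqTrunc]
    exact mul_le_mul_of_nonneg_right (Real.sum_le_exp_of_nonneg (by positivity) K)
      (Real.exp_nonneg _)

theorem IsGaussHermite.sum_expSqTrunc_le {n : ℕ} (hn : 1 ≤ n) {x w : Fin n → ℝ}
    (h : IsGaussHermite n x w) {s : ℝ} (hs0 : 0 ≤ s) (K : ℕ) :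
    ∑ i, w i * (expSqTrunc s K).eval (x i) ≤ gaussExp (expSqTrunc s K) := by
  simp only [expSqTrunc, Polynomial.eval_finsetSum, map_sum, Finset.mul_sum]
  rw [Finset.sum_comm]
  refine Finset.sum_le_sum fun k _ => ?_
  have hk := h.sum_le_gaussExp hn (2 * k) 0 (Nat.zero_le n)
  rw [show realHermite 0 = 1 by simp [realHermite], mul_one] at hk
  simp only [map_smul, Polynomial.eval_smul, smul_eq_mul, mul_left_comm (w _), ← Finset.mul_sum]
  exact mul_le_mul_of_nonneg_left hk (by positivity)

/-- the Gauss–Hermite rule underestimates the integral of exp(s x²/2) for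
0 ≤ s < 1. -/
theorem stmt8 (n : ℕ) (hn : 1 ≤ n) (x w : Fin n → ℝ) (hGH : IsGaussHermite n x w)
    (s : ℝ) (hs0 : 0 ≤ s) (hs1 : s < 1) :
    (∑ i, w i * Real.exp (s * x i ^ 2 / 2) ≤ (1 - s) ^ (-(1 / 2 : ℝ))) ∧
    (1 - s) ^ (-(1 / 2 : ℝ))
      = (Real.sqrt (2 * Real.pi))⁻¹ *
          ∫ t : ℝ, Real.exp (s * t ^ 2 / 2) * Real.exp (-t ^ 2 / 2) := by
  refine ⟨?_, rpow_neg_half_eq_gaussian_integral hs1⟩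
  exact le_of_tendsto'
    (tendsto_finsetSum _ fun i _ => (tendsto_eval_expSqTrunc s (x i)).const_mul (w i))
    fun K => (hGH.sum_expSqTrunc_le hn hs0 K).trans (gaussExp_expSqTrunc_le hs0 hs1 K)

end
end
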